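/- Let k be a field, A a commutative k-algebra, J ⊆ A an ideal, and f ∈ J². Let B be a localization of A⊗_k A in which the diagonal ideal I·B is generated by a regular sequence θ₁, …, θ_d, choose b₁, …, b_d ∈ B with 1⊗f − f⊗1 = Σ_i b_i θ_i, and set C = B[τ₁, …, τ_d][(1 + Σ_i b_i τ_i)^{-1}]/(θ_i − τ_i·(f⊗1), i = 1, …, d). Let K ⊆ A⊗_k A be the kernel of the composite A⊗_k A → A → A/J of the multiplication map and the quotient map. Then the natural (B/KB)-algebra homomorphism from the polynomial ring (B/KB)[τ₁, …, τ_d] to C/KC, sending τ_i to the class of τ_i, is an isomorphism. -/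

import Mathlib

open TensorProduct

/-- `θ 0, θ 1, …, θ (d-1)` is a regular sequence in `B`: each `θ i` is a nonzerodivisor
modulo the ideal generated by the previous ones. -/
def IsRegSeq {B : Type*} [CommRing B] {d : ℕ} (θ : Fin d → B) : Prop :=
  ∀ i : Fin d, ∀ b : B,
    θ i * b ∈ Ideal.span (θ '' {j : Fin d | j < i}) →
      b ∈ Ideal.span (θ '' {j : Fin d | j < i})

noncomputable section

variable (k A : Type) [Field k] [CommRing A] [Algebra k A]
variable (M : Submonoid (A ⊗[k] A)) (B : Type) [CommRing B] [Algebra (A ⊗[k] A) B]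

/-- The diagonal ideal `I = ker(A ⊗_k A → A)`. -/
def Idiag : Ideal (A ⊗[k] A) :=
  RingHom.ker (Algebra.TensorProduct.lmul' k (S := A) : A ⊗[k] A →ₐ[k] A)

variable {d : ℕ} (θ b : Fin d → B) (f : A)

/-- The localization of `B[τ₁, …, τ_d]` at `1 + Σ_i b_i τ_i`. -/
abbrev Lloc : Type :=
  Localization.Away
    ((1 : MvPolynomial (Fin d) B) + ∑ i, MvPolynomial.C (b i) * MvPolynomial.X i)

/-- The ideal of relations `θ_i − τ_i·(f⊗1)`, `i = 1, …, d`. -/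
def relIdeal : Ideal (Lloc B b) :=
  Ideal.span {y | ∃ i : Fin d,
    y = algebraMap (MvPolynomial (Fin d) B) (Lloc B b)
      (MvPolynomial.C (θ i) -
        MvPolynomial.X i * MvPolynomial.C (algebraMap (A ⊗[k] A) B (f ⊗ₜ[k] (1 : A))))}

/-- The ring `C = B[τ₁,…,τ_d][(1 + Σ b_i τ_i)^{-1}] / (θ_i − τ_i·(f⊗1))`. -/
abbrev Cdil : Type := Lloc B b ⧸ relIdeal k A B θ b f

/-- `K ⊆ A ⊗_k A`, the kernel of the composite `A ⊗_k A → A → A/J`. -/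
def Kker (J : Ideal A) : Ideal (A ⊗[k] A) :=
  RingHom.ker ((Ideal.Quotient.mk J).comp
    (Algebra.TensorProduct.lmul' k (S := A) : A ⊗[k] A →ₐ[k] A).toRingHom)

/-- The canonical ring homomorphism `A ⊗_k A → C`. -/
def toCdil : A ⊗[k] A →+* Cdil k A B θ b f :=
  (Ideal.Quotient.mk (relIdeal k A B θ b f)).comp
    ((algebraMap (MvPolynomial (Fin d) B) (Lloc B b)).comp
      ((algebraMap B (MvPolynomial (Fin d) B)).comp (algebraMap (A ⊗[k] A) B)))

/-- `KC`, the ideal of `C` generated by the image of `K`. -/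
def KCideal (J : Ideal A) : Ideal (Cdil k A B θ b f) :=
  Ideal.map (toCdil k A B θ b f) (Kker k A J)

/-- The natural ring homomorphism `B[τ₁,…,τ_d] → C/KC` sending the constants into `C/KC`
via `B → C → C/KC` and `τ_i` to the class of `τ_i`.  The statement that the natural
`(B/KB)`-algebra homomorphism `(B/KB)[τ₁,…,τ_d] → C/KC` is an isomorphism is equivalent to:
this homomorphism is surjective and its kernel is the ideal generated by the constants
coming from `KB`. -/
def Phi (J : Ideal A) : MvPolynomial (Fin d) B →+* Cdil k A B θ b f ⧸ KCideal k A B θ b f J :=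
  MvPolynomial.eval₂Hom
    ((Ideal.Quotient.mk (KCideal k A B θ b f J)).comp
      ((Ideal.Quotient.mk (relIdeal k A B θ b f)).comp
        ((algebraMap (MvPolynomial (Fin d) B) (Lloc B b)).comp
          (algebraMap B (MvPolynomial (Fin d) B)))))
    (fun i => Ideal.Quotient.mk (KCideal k A B θ b f J)
      (Ideal.Quotient.mk (relIdeal k A B θ b f)
        (algebraMap (MvPolynomial (Fin d) B) (Lloc B b) (MvPolynomial.X i))))

/-- The restriction of a regular sequence to its initial segment is regular. -/
lemma IsRegSeq.castSucc {R : Type*} [CommRing R] {d : ℕ} {θ : Fin (d + 1) → R}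
    (h : IsRegSeq θ) : IsRegSeq (fun i : Fin d => θ i.castSucc) := by
  have himg (i : Fin d) : (fun i : Fin d => θ i.castSucc) '' {j | j < i} =
      θ '' {j | j < i.castSucc} := by
    ext x
    constructor
    · rintro ⟨j, hj, rfl⟩
      exact ⟨j.castSucc, by simpa using hj, rfl⟩
    · rintro ⟨j, hj, rfl⟩
      have hj' : j.val < i.val := hj
      exact ⟨⟨j, hj'.trans i.isLt⟩, hj', rfl⟩
  intro i x hx
  rw [himg] at hx ⊢
  exact h i.castSucc x hx

/-- The coefficients of a linear relation among the members of a regular sequence lie in the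
ideal generated by the sequence. -/
lemma IsRegSeq.mem_span_of_sum_eq_zero {R : Type*} [CommRing R] {d : ℕ} {θ : Fin d → R}
    (h : IsRegSeq θ) {a : Fin d → R} (ha : ∑ i, a i * θ i = 0) (i : Fin d) :
    a i ∈ Ideal.span (Set.range θ) := by
  induction d with
  | zero => exact i.elim0
  | succ d ih =>
    have himg : θ '' {j | j < Fin.last d} = Set.range fun i : Fin d => θ i.castSucc := by
      ext x
      constructor
      · rintro ⟨j, hj, rfl⟩
        exact ⟨⟨j.val, hj⟩, rfl⟩
      · rintro ⟨j, rfl⟩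
        exact ⟨j.castSucc, Fin.castSucc_lt_last j, rfl⟩
    have hle : Ideal.span (Set.range fun i : Fin d => θ i.castSucc) ≤
        Ideal.span (Set.range θ) :=
      Ideal.span_mono (by rintro _ ⟨j, rfl⟩; exact ⟨_, rfl⟩)
    rw [Fin.sum_univ_castSucc] at ha
    have hlast : a (Fin.last d) ∈ Ideal.span (Set.range fun i : Fin d => θ i.castSucc) := by
      rw [← himg]
      refine h (Fin.last d) _ ?_
      rw [himg, mul_comm, ← neg_eq_of_add_eq_zero_right ha]
      exact neg_mem <| Ideal.sum_mem _ fun j _ =>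
        Ideal.mul_mem_left _ _ (Ideal.subset_span ⟨j, rfl⟩)
    obtain ⟨e, he⟩ := Ideal.mem_span_range_iff_exists_fun.1 hlast
    refine Fin.lastCases (hle hlast) (fun j => ?_) i
    have hsum : ∑ j : Fin d, (a j.castSucc + e j * θ (Fin.last d)) * θ j.castSucc = 0 := by
      rw [← ha, ← he, Finset.sum_mul, ← Finset.sum_add_distrib]
      exact Finset.sum_congr rfl fun j _ => by ring
    have hj := hle (ih h.castSucc hsum j)
    exact (Ideal.add_mem_iff_left _
      (Ideal.mul_mem_left _ _ (Ideal.subset_span (Set.mem_range_self _)))).1 hj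

/-- If a linear combination of a regular sequence contained in an ideal `𝔞` lies in the product
of `𝔞` with the ideal generated by the sequence, then its coefficients lie in `𝔞`. -/
lemma IsRegSeq.coeff_mem {R : Type*} [CommRing R] {d : ℕ} {θ : Fin d → R}
    (h : IsRegSeq θ) {𝔞 : Ideal R} (hθ : ∀ i, θ i ∈ 𝔞) {a : Fin d → R}
    (ha : ∑ i, a i * θ i ∈ 𝔞 * Ideal.span (Set.range θ)) (i : Fin d) : a i ∈ 𝔞 := by
  rw [← smul_eq_mul, Submodule.mem_ideal_smul_span_iff_exists_sum] at ha
  obtain ⟨c, hc, hsum⟩ := ha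
  rw [Finsupp.sum_fintype _ _ (by simp)] at hsum
  have hdiff : ∑ i, (a i - c i) * θ i = 0 := by
    simp only [sub_mul, Finset.sum_sub_distrib, ← hsum, smul_eq_mul, sub_self]
  have hi := h.mem_span_of_sum_eq_zero hdiff i
  have hle : Ideal.span (Set.range θ) ≤ 𝔞 :=
    Ideal.span_le.2 (by rintro _ ⟨j, rfl⟩; exact hθ j)
  exact (Submodule.sub_mem_iff_left _ (hc i)).1 (hle hi)

lemma mem_Kker (k A : Type) [Field k] [CommRing A] [Algebra k A] (J : Ideal A)
    (x : A ⊗[k] A) : x ∈ Kker k A J ↔ Algebra.TensorProduct.lmul' k (S := A) x ∈ J := by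
  rw [Kker, RingHom.mem_ker]
  exact Ideal.Quotient.eq_zero_iff_mem

lemma Idiag_le_Kker (k A : Type) [Field k] [CommRing A] [Algebra k A] (J : Ideal A) :
    Idiag k A ≤ Kker k A J := by
  intro x hx
  rw [mem_Kker, show Algebra.TensorProduct.lmul' k (S := A) x = 0 from hx]
  exact J.zero_mem

/-- For `f ∈ J²` the difference `1 ⊗ f - f ⊗ 1` lies in `K · I`. -/
lemma one_tmul_sub_tmul_one_mem (k A : Type) [Field k] [CommRing A] [Algebra k A] (J : Ideal A)
    {f : A} (hf : f ∈ J ^ 2) :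
    (1 : A) ⊗ₜ[k] f - f ⊗ₜ[k] (1 : A) ∈ Kker k A J * Idiag k A := by
  have hI (x : A) : (1 : A) ⊗ₜ[k] x - x ⊗ₜ[k] (1 : A) ∈ Idiag k A := by
    simp [Idiag, RingHom.mem_ker]
  rw [pow_two] at hf
  induction hf using Submodule.mul_induction_on' with
  | mem_mul_mem x hx y hy =>
    have hsplit : (1 : A) ⊗ₜ[k] (x * y) - (x * y) ⊗ₜ[k] (1 : A) =
        (1 : A) ⊗ₜ[k] x * ((1 : A) ⊗ₜ[k] y - y ⊗ₜ[k] (1 : A)) +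
          y ⊗ₜ[k] (1 : A) * ((1 : A) ⊗ₜ[k] x - x ⊗ₜ[k] (1 : A)) := by
      simp only [mul_sub, Algebra.TensorProduct.tmul_mul_tmul, one_mul, mul_one, mul_comm y x]
      ring
    rw [hsplit]
    refine add_mem (Ideal.mul_mem_mul ?_ (hI y)) (Ideal.mul_mem_mul ?_ (hI x)) <;>
      rw [mem_Kker] <;> simpa
  | add x _ y _ hx hy =>
    have hadd : (1 : A) ⊗ₜ[k] (x + y) - (x + y) ⊗ₜ[k] (1 : A) =
        ((1 : A) ⊗ₜ[k] x - x ⊗ₜ[k] (1 : A)) + ((1 : A) ⊗ₜ[k] y - y ⊗ₜ[k] (1 : A)) := by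
      rw [tmul_add, add_tmul]
      ring
    rw [hadd]
    exact add_mem hx hy

/-- Let `N` be an ideal of `P`, `L` the localization of `P` at an element `u ≡ 1` modulo `N`, and
`𝔯` an ideal of `L` contained in `N L`. Then the quotient of `L ⧸ 𝔯` by the extension of `N`
is `P ⧸ N`. -/
lemma quotient_away_quotient_bijective {P L : Type*} [CommRing P] [CommRing L] [Algebra P L]
    {u : P} [IsLocalization.Away u L] {N : Ideal P} (hu : u - 1 ∈ N) {𝔯 : Ideal L}
    (hr : 𝔯 ≤ N.map (algebraMap P L)) {𝔨 : Ideal (L ⧸ 𝔯)}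
    (hk : 𝔨 = N.map ((Ideal.Quotient.mk 𝔯).comp (algebraMap P L))) {φ : P →+* (L ⧸ 𝔯) ⧸ 𝔨}
    (hφ : φ = (Ideal.Quotient.mk 𝔨).comp ((Ideal.Quotient.mk 𝔯).comp (algebraMap P L))) :
    Function.Surjective φ ∧ RingHom.ker φ = N := by
  have hker : N ≤ RingHom.ker φ := by
    intro x hx
    rw [RingHom.mem_ker, hφ, RingHom.comp_apply, Ideal.Quotient.eq_zero_iff_mem, hk]
    exact Ideal.mem_map_of_mem _ hx
  have hφu : φ u = 1 := by
    have h := hker hu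
    rwa [RingHom.mem_ker, map_sub, map_one, sub_eq_zero] at h
  have hφ' (p : P) : φ p = Ideal.Quotient.mk 𝔨 (Ideal.Quotient.mk 𝔯 (algebraMap P L p)) := by
    rw [hφ]; rfl
  refine ⟨fun y => ?_, le_antisymm (fun p hp => ?_) hker⟩
  · obtain ⟨y, rfl⟩ := Ideal.Quotient.mk_surjective y
    obtain ⟨z, rfl⟩ := Ideal.Quotient.mk_surjective y
    obtain ⟨⟨p, s, n, hs⟩, hz⟩ := IsLocalization.surj (Submonoid.powers u) z
    refine ⟨p, ?_⟩
    have hzφ := congrArg (fun w => Ideal.Quotient.mk 𝔨 (Ideal.Quotient.mk 𝔯 w)) hz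
    simp only [map_mul, ← hφ'] at hzφ
    rw [← hzφ, ← hs]
    simp only [map_pow, hφu, one_pow, mul_one]
  · have hunit : IsUnit (Ideal.Quotient.mk N u) := by
      rw [← sub_add_cancel u 1, map_add, Ideal.Quotient.eq_zero_iff_mem.2 hu]
      simp
    let ψ : L →+* P ⧸ N := IsLocalization.Away.lift u hunit
    have hψ (q : P) : ψ (algebraMap P L q) = Ideal.Quotient.mk N q :=
      IsLocalization.Away.lift_eq u hunit q
    have hψr : ∀ x ∈ 𝔯, ψ x = 0 := by
      suffices N.map (algebraMap P L) ≤ RingHom.ker ψ from fun x hx => this (hr hx)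
      refine Ideal.map_le_iff_le_comap.2 fun x hx => ?_
      rw [Ideal.mem_comap, RingHom.mem_ker, hψ, Ideal.Quotient.eq_zero_iff_mem]
      exact hx
    have hψk : 𝔨 ≤ RingHom.ker (Ideal.Quotient.lift 𝔯 ψ hψr) := by
      rw [hk, Ideal.map_le_iff_le_comap]
      intro x hx
      rw [Ideal.mem_comap, RingHom.mem_ker, RingHom.comp_apply, Ideal.Quotient.lift_mk, hψ,
        Ideal.Quotient.eq_zero_iff_mem]
      exact hx
    rw [RingHom.mem_ker, hφ', Ideal.Quotient.eq_zero_iff_mem] at hp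
    have hp' := hψk hp
    rwa [RingHom.mem_ker, Ideal.Quotient.lift_mk, hψ, Ideal.Quotient.eq_zero_iff_mem] at hp'

/-!
STATEMENT 10.
Let `k` be a field, `A` a commutative `k`-algebra, `J ⊆ A` an ideal, and `f ∈ J²`.  Let `B`
be a localization of `A ⊗_k A` in which the diagonal ideal `I·B` is generated by a regular
sequence `θ₁, …, θ_d`, choose `b₁, …, b_d ∈ B` with `1⊗f − f⊗1 = Σ_i b_i θ_i`, and set
`C = B[τ₁,…,τ_d][(1 + Σ_i b_i τ_i)^{-1}]/(θ_i − τ_i·(f⊗1), i = 1,…,d)`.  Let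
`K ⊆ A ⊗_k A` be the kernel of the composite `A ⊗_k A → A → A/J`.  Then the natural
`(B/KB)`-algebra homomorphism `(B/KB)[τ₁,…,τ_d] → C/KC` sending `τ_i` to the class of
`τ_i` is an isomorphism.  (Formalized equivalently: the natural homomorphism
`Φ : B[τ₁,…,τ_d] → C/KC` is surjective with kernel the ideal generated by the image of
`KB` under the constants embedding.)
-/
theorem stmt10 [IsLocalization M B]
    (J : Ideal A) (f : A) (hf : f ∈ J ^ 2)
    (d : ℕ) (θ : Fin d → B) (hreg : IsRegSeq θ)
    (hgen : Ideal.span (Set.range θ) = Ideal.map (algebraMap (A ⊗[k] A) B) (Idiag k A))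
    (b : Fin d → B)
    (hb : algebraMap (A ⊗[k] A) B ((1 : A) ⊗ₜ[k] f - f ⊗ₜ[k] (1 : A)) = ∑ i, b i * θ i) :
    Function.Surjective (Phi k A B θ b f J) ∧
      RingHom.ker (Phi k A B θ b f J) =
        Ideal.map (MvPolynomial.C : B →+* MvPolynomial (Fin d) B)
          (Ideal.map (algebraMap (A ⊗[k] A) B) (Kker k A J)) := by
  set g := algebraMap (A ⊗[k] A) B with hg
  set KB := Ideal.map g (Kker k A J) with hKB
  set N := Ideal.map (MvPolynomial.C : B →+* MvPolynomial (Fin d) B) KB with hN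
  have hθ : ∀ i, θ i ∈ KB := fun i =>
    Ideal.map_mono (Idiag_le_Kker k A J) (hgen ▸ Ideal.subset_span ⟨i, rfl⟩)
  have hbK : ∀ i, b i ∈ KB := by
    have h1 : ∑ i, b i * θ i ∈ KB * Ideal.span (Set.range θ) := by
      rw [← hb, hgen, hKB, ← Ideal.map_mul]
      exact Ideal.mem_map_of_mem _ (one_tmul_sub_tmul_one_mem k A J hf)
    exact hreg.coeff_mem hθ h1
  have hfK : g (f ⊗ₜ[k] (1 : A)) ∈ KB := by
    refine Ideal.mem_map_of_mem _ ?_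
    rw [mem_Kker]
    simpa using Ideal.pow_le_self two_ne_zero hf
  set u : MvPolynomial (Fin d) B :=
    1 + ∑ i, MvPolynomial.C (b i) * MvPolynomial.X i with hu
  have huN : u - 1 ∈ N := by
    rw [hu, add_sub_cancel_left]
    exact Ideal.sum_mem _ fun i _ =>
      Ideal.mul_mem_right _ _ (Ideal.mem_map_of_mem _ (hbK i))
  refine quotient_away_quotient_bijective huN (𝔨 := KCideal k A B θ b f J) ?_ ?_ ?_
  · rw [relIdeal, Ideal.span_le]
    rintro _ ⟨i, rfl⟩
    exact Ideal.mem_map_of_mem _ <| Ideal.sub_mem _ (Ideal.mem_map_of_mem _ (hθ i))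
      (Ideal.mul_mem_left _ _ (Ideal.mem_map_of_mem _ hfK))
  · rw [KCideal, hN, hKB, Ideal.map_map, Ideal.map_map]
    rfl
  · refine MvPolynomial.ringHom_ext (fun r => ?_) (fun i => ?_)
    · exact MvPolynomial.eval₂Hom_C _ _ r
    · exact MvPolynomial.eval₂Hom_X' _ _ i

end
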